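/- Let Ω ⊆ ℝ^N be a domain whose boundary Γ is nonempty and satisfies Γ = ∂(ℝ^N \ Ω̄), let 1 < p < ∞, and let u be a bounded viscosity solution of problem (P) in Ω with 0 < u < 1 on Ω×(0,∞). Suppose Σ ⊆ Ω is a nonempty set which is time-invariant for u, i.e., there exists a function a : (0,∞) → ℝ with u(x,t) = a(t) for every x ∈ Σ and every t > 0. Then there exists R > 0 such that d_Γ(x) = R for every x ∈ Σ. -/

import Mathlib

open MeasureTheory Metric Set Filter
open scoped Topology ENNReal NNReal Real Classical

noncomputable section

/-- The Hessian matrix of a real-valued function, via the second iterated Fréchet derivative. -/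
noncomputable def hess {N : ℕ} (f : EuclideanSpace ℝ (Fin N) → ℝ) (x : EuclideanSpace ℝ (Fin N)) :
    Matrix (Fin N) (Fin N) ℝ :=
  fun i j => iteratedFDeriv ℝ 2 f x ![EuclideanSpace.single i 1, EuclideanSpace.single j 1]

/-- The quadratic form ⟨Xv, v⟩ associated to a matrix. -/
noncomputable def qform {N : ℕ} (X : Matrix (Fin N) (Fin N) ℝ) (v : EuclideanSpace ℝ (Fin N)) : ℝ :=
  ∑ i, ∑ j, X i j * v j * v i

/-- Smallest eigenvalue (via the Rayleigh quotient) of a symmetric matrix. -/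
noncomputable def lamMin {N : ℕ} (X : Matrix (Fin N) (Fin N) ℝ) : ℝ :=
  sInf {r | ∃ v : EuclideanSpace ℝ (Fin N), ‖v‖ = 1 ∧ r = qform X v}

/-- Largest eigenvalue (via the Rayleigh quotient) of a symmetric matrix. -/
noncomputable def lamMax {N : ℕ} (X : Matrix (Fin N) (Fin N) ℝ) : ℝ :=
  sSup {r | ∃ v : EuclideanSpace ℝ (Fin N), ‖v‖ = 1 ∧ r = qform X v}

/-- F(ξ, X) = (1/p)[tr X + (p−2)⟨Xξ,ξ⟩/|ξ|²]. -/
noncomputable def Fop {N : ℕ} (p : ℝ) (ξ : EuclideanSpace ℝ (Fin N))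
    (X : Matrix (Fin N) (Fin N) ℝ) : ℝ :=
  (1/p) * (Matrix.trace X + (p - 2) * qform X ξ / ‖ξ‖^2)

/-- Lower semicontinuous relaxation F_*. -/
noncomputable def Flower {N : ℕ} (p : ℝ) (ξ : EuclideanSpace ℝ (Fin N))
    (X : Matrix (Fin N) (Fin N) ℝ) : ℝ :=
  if ξ = 0 then
    (1/p) * (Matrix.trace X + max (p - 2) 0 * lamMin X + min (p - 2) 0 * lamMax X)
  else Fop p ξ X

/-- Upper semicontinuous relaxation F^*. -/
noncomputable def Fupper {N : ℕ} (p : ℝ) (ξ : EuclideanSpace ℝ (Fin N))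
    (X : Matrix (Fin N) (Fin N) ℝ) : ℝ :=
  if ξ = 0 then
    (1/p) * (Matrix.trace X + min (p - 2) 0 * lamMin X + max (p - 2) 0 * lamMax X)
  else Fop p ξ X

/-- Viscosity solution of `u_t = Δ_p^G u` in `Ω × (0,∞)`. -/
def IsViscositySol {N : ℕ} (p : ℝ) (Ω : Set (EuclideanSpace ℝ (Fin N)))
    (u : EuclideanSpace ℝ (Fin N) → ℝ → ℝ) : Prop :=
  ContinuousOn (fun q : EuclideanSpace ℝ (Fin N) × ℝ => u q.1 q.2) (Ω ×ˢ Set.Ioi 0) ∧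
  (∀ φ : EuclideanSpace ℝ (Fin N) × ℝ → ℝ, ContDiff ℝ 2 φ →
    ∀ x ∈ Ω, ∀ t ∈ Set.Ioi (0:ℝ),
      IsLocalMaxOn (fun q : EuclideanSpace ℝ (Fin N) × ℝ => u q.1 q.2 - φ q)
        (Ω ×ˢ Set.Ioi 0) (x, t) →
      deriv (fun s => φ (x, s)) t ≤
        Fupper p (gradient (fun y => φ (y, t)) x) (hess (fun y => φ (y, t)) x)) ∧
  (∀ φ : EuclideanSpace ℝ (Fin N) × ℝ → ℝ, ContDiff ℝ 2 φ →
    ∀ x ∈ Ω, ∀ t ∈ Set.Ioi (0:ℝ),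
      IsLocalMinOn (fun q : EuclideanSpace ℝ (Fin N) × ℝ => u q.1 q.2 - φ q)
        (Ω ×ˢ Set.Ioi 0) (x, t) →
      Flower p (gradient (fun y => φ (y, t)) x) (hess (fun y => φ (y, t)) x) ≤
        deriv (fun s => φ (x, s)) t)

/-- Bounded (viscosity) solution of problem (P): `u_t = Δ_p^G u` in `Ω × (0,∞)`,
`u = 0` on `Ω × {0}`, `u = 1` on `Γ × (0,∞)`; continuous away from `Γ × {0}`. -/
def IsSolP {N : ℕ} (p : ℝ) (Ω : Set (EuclideanSpace ℝ (Fin N)))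
    (u : EuclideanSpace ℝ (Fin N) → ℝ → ℝ) : Prop :=
  (∃ M : ℝ, ∀ x ∈ closure Ω, ∀ t : ℝ, 0 ≤ t → |u x t| ≤ M) ∧
  (∀ x ∈ closure Ω, ∀ t : ℝ, 0 ≤ t → ¬(x ∈ frontier Ω ∧ t = 0) →
    ContinuousWithinAt (fun q : EuclideanSpace ℝ (Fin N) × ℝ => u q.1 q.2)
      (closure Ω ×ˢ Set.Ici 0) (x, t)) ∧
  IsViscositySol p Ω u ∧
  (∀ x ∈ Ω, u x 0 = 0) ∧
  (∀ y ∈ frontier Ω, ∀ t : ℝ, 0 < t → u y t = 1)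

/-- Viscosity solution of the elliptic equation `u − ε² Δ_p^G u = 0` in `Ω`. -/
def IsEllipticViscositySol {N : ℕ} (p ε : ℝ) (Ω : Set (EuclideanSpace ℝ (Fin N)))
    (u : EuclideanSpace ℝ (Fin N) → ℝ) : Prop :=
  ContinuousOn u Ω ∧
  (∀ φ : EuclideanSpace ℝ (Fin N) → ℝ, ContDiff ℝ 2 φ → ∀ x ∈ Ω,
      IsLocalMaxOn (fun y => u y - φ y) Ω x →
      φ x - ε^2 * Fupper p (gradient φ x) (hess φ x) ≤ 0) ∧
  (∀ φ : EuclideanSpace ℝ (Fin N) → ℝ, ContDiff ℝ 2 φ → ∀ x ∈ Ω,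
      IsLocalMinOn (fun y => u y - φ y) Ω x →
      0 ≤ φ x - ε^2 * Flower p (gradient φ x) (hess φ x))

/-- The complementary error function. -/
noncomputable def Erfc (σ : ℝ) : ℝ := (2 / Real.sqrt π) * ∫ τ in Set.Ioi σ, Real.exp (-τ^2)

/-- The explicit radially symmetric solution `u^ε` of the elliptic problem in the ball `B_R`. -/
noncomputable def uEps (N : ℕ) (p R ε : ℝ) (x : EuclideanSpace ℝ (Fin N)) : ℝ :=
  (∫ θ in (0:ℝ)..π,
      Real.exp (Real.sqrt (p/(p-1)) * (‖x‖/ε) * Real.cos θ) * (Real.sin θ) ^ (((N:ℝ) - p)/(p-1))) /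
  (∫ θ in (0:ℝ)..π,
      Real.exp (Real.sqrt (p/(p-1)) * (R/ε) * Real.cos θ) * (Real.sin θ) ^ (((N:ℝ) - p)/(p-1)))

lemma qform_smul_one_add_outer {N : ℕ} (a b : ℝ) (w v : EuclideanSpace ℝ (Fin N)) :
    qform (fun i j => (if i = j then a else 0) + b * (w i * w j)) v =
      a * ‖v‖ ^ 2 + b * (inner ℝ w v) ^ 2 := by
  have hin : inner ℝ w v = ∑ i, w i * v i := by
    simp [PiLp.inner_apply, mul_comm]
  rw [EuclideanSpace.real_norm_sq_eq, hin, sq (∑ i, w i * v i), Finset.sum_mul_sum]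
  simp only [qform, Finset.mul_sum, ← Finset.sum_add_distrib]
  refine Finset.sum_congr rfl fun i _ => ?_
  have h1 : ∀ j, ((if i = j then a else 0) + b * (w i * w j)) * v j * v i =
      (if i = j then a * v j * v i else 0) + b * (w i * v i * (w j * v j)) := by
    intro j
    split_ifs <;> ring
  simp only [h1, Finset.sum_add_distrib, Finset.sum_ite_eq, Finset.mem_univ, if_true]
  ring

lemma hasFDerivAt_radial {N : ℕ} {G : ℝ → ℝ} {g : ℝ} (z x : EuclideanSpace ℝ (Fin N))
    (hG : HasDerivAt G g (‖x - z‖ ^ 2)) :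
    HasFDerivAt (fun y => G (‖y - z‖ ^ 2)) ((2 * g) • innerSL ℝ (x - z)) x := by
  have h1 : HasFDerivAt (fun y : EuclideanSpace ℝ (Fin N) => ‖y - z‖ ^ 2)
      (2 • innerSL ℝ (x - z)) x :=
    ((hasFDerivAt_id x).sub_const z).norm_sq
  refine (hG.comp_hasFDerivAt x h1).congr_fderiv ?_
  rw [← Nat.cast_smul_eq_nsmul ℝ, smul_smul]
  congr 1
  push_cast
  ring

section radial

variable {N : ℕ} {G G₁ : ℝ → ℝ} {g₂ : ℝ} {z x : EuclideanSpace ℝ (Fin N)}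

lemma gradient_radial {g : ℝ} (hG : HasDerivAt G g (‖x - z‖ ^ 2)) :
    gradient (fun y => G (‖y - z‖ ^ 2)) x = (2 * g) • (x - z) := by
  refine HasGradientAt.gradient ?_
  rw [hasGradientAt_iff_hasFDerivAt]
  refine (hasFDerivAt_radial z x hG).congr_fderiv ?_
  rw [map_smul]
  rfl

lemma hess_radial (hG : ∀ s, 0 ≤ s → HasDerivAt G (G₁ s) s)
    (hG₁ : HasDerivAt G₁ g₂ (‖x - z‖ ^ 2)) :
    hess (fun y => G (‖y - z‖ ^ 2)) x = fun i j =>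
      (if i = j then 2 * G₁ (‖x - z‖ ^ 2) else 0) + 4 * g₂ * ((x - z) i * (x - z) j) := by
  have hf : fderiv ℝ (fun y : EuclideanSpace ℝ (Fin N) => G (‖y - z‖ ^ 2)) =
      fun y => (2 * G₁ (‖y - z‖ ^ 2)) • innerSL ℝ (y - z) := by
    funext y
    exact (hasFDerivAt_radial z y (hG _ (by positivity))).fderiv
  have h1 : HasFDerivAt (fun y : EuclideanSpace ℝ (Fin N) => 2 * G₁ (‖y - z‖ ^ 2))
      ((2 : ℝ) • ((2 * g₂) • innerSL ℝ (x - z))) x :=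
    (hasFDerivAt_radial z x hG₁).const_mul 2
  have h2 : HasFDerivAt (fun y : EuclideanSpace ℝ (Fin N) => innerSL ℝ (y - z)) (innerSL ℝ) x :=
    (innerSL ℝ (E := EuclideanSpace ℝ (Fin N))).hasFDerivAt.comp x
      ((hasFDerivAt_id x).sub_const z)
  have h3 := (h1.smul h2).fderiv
  funext i j
  simp only [hess, iteratedFDeriv_two_apply, hf]
  have h4 : innerSL ℝ (EuclideanSpace.single i (1 : ℝ)) (EuclideanSpace.single j 1) =
      if i = j then 1 else 0 := by
    simp [innerSL_apply_apply, EuclideanSpace.inner_single_left, eq_comm (a := i)]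
  erw [h3]
  simp only [FunLike.coe_add, FunLike.coe_smul, Pi.add_apply, Pi.smul_apply,
    ContinuousLinearMap.smulRight_apply, smul_eq_mul, Matrix.cons_val_zero, Matrix.cons_val_one,
    h4]
  simp [EuclideanSpace.inner_single_right]
  ring

lemma inf_sup_rayleigh_smul_one (hN : 1 ≤ N) (a : ℝ) (X : Matrix (Fin N) (Fin N) ℝ)
    (hX : ∀ v, qform X v = a * ‖v‖ ^ 2) : lamMin X = a ∧ lamMax X = a := by
  have hset : {r | ∃ v : EuclideanSpace ℝ (Fin N), ‖v‖ = 1 ∧ r = qform X v} = {a} := by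
    ext r
    constructor
    · rintro ⟨v, hv, rfl⟩
      simp [hX, hv]
    · rintro rfl
      exact ⟨EuclideanSpace.single ⟨0, hN⟩ 1, by simp, by simp [hX]⟩
  simp [lamMin, lamMax, hset]

/-- Both relaxations of the operator agree, and are explicit, on a radial function whose
profile has nonvanishing derivative. -/
lemma Fupper_Flower_radial (hN : 1 ≤ N) (p : ℝ)
    (hG : ∀ s, 0 ≤ s → HasDerivAt G (G₁ s) s)
    (hG₁ : HasDerivAt G₁ g₂ (‖x - z‖ ^ 2)) (hne : G₁ (‖x - z‖ ^ 2) ≠ 0) :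
    Fupper p (gradient (fun y => G (‖y - z‖ ^ 2)) x) (hess (fun y => G (‖y - z‖ ^ 2)) x) =
      (1 / p) * (2 * (N + p - 2) * G₁ (‖x - z‖ ^ 2) + 4 * (p - 1) * ‖x - z‖ ^ 2 * g₂) ∧
    Flower p (gradient (fun y => G (‖y - z‖ ^ 2)) x) (hess (fun y => G (‖y - z‖ ^ 2)) x) =
      (1 / p) * (2 * (N + p - 2) * G₁ (‖x - z‖ ^ 2) + 4 * (p - 1) * ‖x - z‖ ^ 2 * g₂) := by
  rw [gradient_radial (hG _ (by positivity)), hess_radial hG hG₁]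
  set w := x - z
  set g₁ := G₁ (‖w‖ ^ 2)
  have htr : Matrix.trace (fun i j => (if i = j then 2 * g₁ else 0) + 4 * g₂ * (w i * w j)) =
      N * (2 * g₁) + 4 * g₂ * ‖w‖ ^ 2 := by
    rw [EuclideanSpace.real_norm_sq_eq]
    simp [Matrix.trace, Matrix.diag, Finset.sum_add_distrib, Finset.mul_sum, sq]
  have hq := qform_smul_one_add_outer (2 * g₁) (4 * g₂) w
  unfold Fupper Flower Fop
  rw [htr]
  by_cases hw : w = 0
  · obtain ⟨h1, h2⟩ := inf_sup_rayleigh_smul_one hN (2 * g₁)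
      (fun i j => (if i = j then 2 * g₁ else 0) + 4 * g₂ * (w i * w j))
      (fun v => by rw [hq v, hw]; simp)
    have h3 : min (p - 2) 0 + max (p - 2) 0 = p - 2 := by rw [min_add_max]; ring
    rw [h1, h2]
    simp only [hw, smul_zero, if_true, norm_zero]
    constructor <;> linear_combination (1 / p) * (2 * g₁) * h3
  · have hw' : (2 * g₁) • w ≠ 0 := smul_ne_zero (by simpa using hne) hw
    have hn : ‖w‖ ≠ 0 := by simpa using hw
    have key : (p - 2) * qform (fun i j => (if i = j then 2 * g₁ else 0) + 4 * g₂ * (w i * w j))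
        ((2 * g₁) • w) / ‖(2 * g₁) • w‖ ^ 2 = (p - 2) * (2 * g₁ + 4 * g₂ * ‖w‖ ^ 2) := by
      rw [hq, inner_smul_right, real_inner_self_eq_norm_sq, norm_smul, Real.norm_eq_abs,
        mul_pow, sq_abs]
      field_simp
    simp only [hw', if_false, key]
    constructor <;> ring

end radial

lemma closedBall_subset_of_lt_infDist_frontier {N : ℕ} {Ω : Set (EuclideanSpace ℝ (Fin N))}
    (hΩo : IsOpen Ω) {y : EuclideanSpace ℝ (Fin N)} (hy : y ∈ Ω) {r : ℝ} (hr0 : 0 ≤ r)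
    (hr : r < infDist y (frontier Ω)) : closedBall y r ⊆ Ω := by
  refine (convex_closedBall y r).isPreconnected.subset_left_of_subset_union hΩo
    isClosed_closure.isOpen_compl
    (disjoint_compl_right.mono_left subset_closure) ?_ ⟨y, mem_closedBall_self hr0, hy⟩
  intro x hx
  by_contra hcon
  simp only [mem_union, mem_compl_iff, not_or, not_not] at hcon
  have hxf : x ∈ frontier Ω := by
    rw [hΩo.frontier_eq]
    exact ⟨hcon.2, hcon.1⟩
  have := infDist_le_dist_of_mem (x := y) hxf
  rw [mem_closedBall, dist_comm] at hx
  linarith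

/-- Comparison from above on a ball with the barrier
`exp (l t + μ (√(|x - y|² + δ²) - √(r² + δ²)))`. -/
lemma sol_le_exp_of_closedBall_subset {N : ℕ} (hN : 2 ≤ N) {p : ℝ} (hp : 1 < p)
    {Ω : Set (EuclideanSpace ℝ (Fin N))} (hΩo : IsOpen Ω)
    {u : EuclideanSpace ℝ (Fin N) → ℝ → ℝ} (hu : IsSolP p Ω u)
    (hu1 : ∀ x ∈ Ω, ∀ t : ℝ, 0 < t → u x t < 1)
    {y : EuclideanSpace ℝ (Fin N)} {r δ μ : ℝ} (hr : 0 < r) (hδ : 0 < δ) (hμ : 0 < μ)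
    (hball : closedBall y r ⊆ Ω) {t : ℝ} (ht : 0 < t) :
    u y t ≤ Real.exp (((p - 1) * μ ^ 2 + (N + p - 2) * μ / δ) / p * t - μ * (r - δ)) := by
  have hp1 : 0 < p - 1 := by linarith
  have hp0 : 0 < p := by linarith
  have hNp : 0 < (N : ℝ) + p - 2 := by
    have : (2 : ℝ) ≤ N := by exact_mod_cast hN
    linarith
  set l : ℝ := ((p - 1) * μ ^ 2 + (N + p - 2) * μ / δ) / p with hl
  have hl0 : 0 < l := by positivity
  set c : ℝ := √(r ^ 2 + δ ^ 2) with hc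
  have hrc : r ≤ c := Real.le_sqrt_of_sq_le (by nlinarith [sq_nonneg δ])
  set φ : EuclideanSpace ℝ (Fin N) × ℝ → ℝ :=
    fun q => Real.exp (l * q.2 + μ * (√(‖q.1 - y‖ ^ 2 + δ ^ 2) - c)) with hφ
  have hpos : ∀ s : ℝ, 0 ≤ s → 0 < s + δ ^ 2 := fun s hs => by positivity
  have hφC : ContDiff ℝ 2 φ := by
    refine Real.contDiff_exp.comp ((contDiff_const.mul contDiff_snd).add
      (contDiff_const.mul ((ContDiff.sqrt ?_ ?_).sub contDiff_const)))
    · exact ((contDiff_fst.sub contDiff_const).norm_sq ℝ).add contDiff_const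
    · intro q
      exact (hpos _ (by positivity)).ne'
  have hsub : ∀ x ∈ closedBall y r, ∀ t, 0 ≤ t → u x t ≤ φ (x, t) := by
    by_contra! hcon
    obtain ⟨x₁, hx₁, t₁, ht₁, hlt₁⟩ := hcon
    set T : ℝ := max (t₁ + 1) (μ * c / l) with hT
    have hT0 : 0 < T := lt_of_lt_of_le (by linarith) (le_max_left _ _)
    have hφT : ∀ x, 1 ≤ φ (x, T) := by
      intro x
      refine Real.one_le_exp ?_
      have h1 : μ * c ≤ l * T := by
        have := (div_le_iff₀ hl0).1 (le_max_right (t₁ + 1) (μ * c / l))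
        rw [← hT] at this
        linarith
      have h2 : 0 ≤ μ * √(‖x - y‖ ^ 2 + δ ^ 2) := by positivity
      simp only
      linarith
    have hcont : ContinuousOn (fun q : EuclideanSpace ℝ (Fin N) × ℝ => u q.1 q.2 - φ q)
        (closedBall y r ×ˢ Icc 0 T) := by
      refine ContinuousOn.sub ?_ hφC.continuous.continuousOn
      rintro ⟨x, s⟩ ⟨hx, hs⟩
      have hxΩ := hball hx
      have hfr : x ∉ frontier Ω := fun h => (hΩo.frontier_eq ▸ h).2 hxΩ
      exact (hu.2.1 x (subset_closure hxΩ) s hs.1 fun h => hfr h.1).mono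
        (prod_mono (hball.trans subset_closure) fun _ h => h.1)
    obtain ⟨⟨x₀, t₀⟩, ⟨hx₀, ht₀⟩, hmax⟩ :=
      ((isCompact_closedBall y r).prod isCompact_Icc).exists_isMaxOn
        ⟨(x₁, t₁), hx₁, ht₁, (by linarith : t₁ ≤ t₁ + 1).trans (le_max_left _ _)⟩ hcont
    simp only at hx₀ ht₀
    have hx₀Ω := hball hx₀
    have hval : φ (x₀, t₀) < u x₀ t₀ := by
      have := hmax (show (x₁, t₁) ∈ closedBall y r ×ˢ Icc 0 T from
        ⟨hx₁, ht₁, (by linarith : t₁ ≤ t₁ + 1).trans (le_max_left _ _)⟩)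
      simp only [mem_ofPred_eq] at this
      linarith
    have hφ0 : 0 < φ (x₀, t₀) := Real.exp_pos _
    have ht₀pos : 0 < t₀ := by
      refine lt_of_le_of_ne ht₀.1 fun h => ?_
      rw [← h, hu.2.2.2.1 x₀ hx₀Ω, h] at hval
      linarith
    have hu₀ := hu1 x₀ hx₀Ω t₀ ht₀pos
    have ht₀T : t₀ < T := by
      refine lt_of_le_of_ne ht₀.2 fun h => ?_
      have := hφT x₀
      rw [← h] at this
      linarith
    have hx₀r : x₀ ∈ ball y r := by
      rw [mem_ball]
      refine lt_of_le_of_ne hx₀ fun h => ?_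
      rw [dist_eq_norm] at h
      have : 1 ≤ φ (x₀, t₀) := by
        refine Real.one_le_exp ?_
        simp only [h, ← hc, sub_self, mul_zero, add_zero]
        positivity
      linarith
    have hloc : IsLocalMax (fun q : EuclideanSpace ℝ (Fin N) × ℝ => u q.1 q.2 - φ q) (x₀, t₀) :=
      hmax.isLocalMax (prod_mem_nhds
        (mem_of_superset (isOpen_ball.mem_nhds hx₀r) ball_subset_closedBall)
        (Icc_mem_nhds ht₀pos ht₀T))
    have hvisc := hu.2.2.1.2.1 φ hφC x₀ hx₀Ω t₀ ht₀pos (hloc.on _)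
    set G : ℝ → ℝ := fun s => Real.exp (l * t₀ + μ * (√(s + δ ^ 2) - c)) with hGdef
    have hsqrt : ∀ s, 0 ≤ s → HasDerivAt (fun s => √(s + δ ^ 2)) (1 / (2 * √(s + δ ^ 2))) s :=
      fun s hs => ((hasDerivAt_id s).add_const (δ ^ 2)).sqrt (hpos s hs).ne'
    have hG : ∀ s, 0 ≤ s →
        HasDerivAt G (G s * (μ * (1 / (2 * √(s + δ ^ 2))))) s := fun s hs =>
      ((((hsqrt s hs).sub_const c).const_mul μ).const_add (l * t₀)).exp
    set s₀ := ‖x₀ - y‖ ^ 2 with hs₀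
    have hs₀0 : 0 ≤ s₀ := by positivity
    set h := √(s₀ + δ ^ 2) with hh
    have hh2 : h ^ 2 = s₀ + δ ^ 2 := Real.sq_sqrt (hpos _ hs₀0).le
    have hδh : δ ≤ h := Real.le_sqrt_of_sq_le (by linarith)
    have hh0 : 0 < h := by linarith
    have hG₁ : HasDerivAt (fun s => G s * (μ * (1 / (2 * √(s + δ ^ 2)))))
        (G s₀ * (μ ^ 2 / (4 * h ^ 2) - μ / (4 * h ^ 3))) s₀ := by
      have h1 : HasDerivAt (fun s => (μ * (1 / (2 * √(s + δ ^ 2)))))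
          (μ * (-(2 * (1 / (2 * h))) / (2 * h) ^ 2)) s₀ := by
        simp only [one_div]
        exact (((hsqrt s₀ hs₀0).const_mul 2).inv (by positivity)).const_mul μ |>.congr_deriv (by
          simp only [one_div]; rfl)
      refine ((hG s₀ hs₀0).mul h1).congr_deriv ?_
      rw [← hh]
      field_simp
      ring
    have hG0 : 0 < G s₀ := Real.exp_pos _
    have hrad := (Fupper_Flower_radial (z := y) (x := x₀) (by omega) p hG hG₁
      (by rw [← hs₀, ← hh]; positivity)).1
    have hder : deriv (fun s => φ (x₀, s)) t₀ = l * G s₀ := by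
      have : HasDerivAt (fun s => φ (x₀, s)) (G s₀ * (l * 1)) t₀ :=
        (((hasDerivAt_id' t₀).const_mul l).add_const (μ * (h - c))).exp
      rw [this.deriv]
      ring
    rw [hder] at hvisc
    rw [show (fun z => φ (z, t₀)) = fun z => G (‖z - y‖ ^ 2) from rfl, hrad, ← hs₀, ← hh] at hvisc
    have hexp : 1 / p * (2 * (N + p - 2) * (G s₀ * (μ * (1 / (2 * h)))) +
        4 * (p - 1) * s₀ * (G s₀ * (μ ^ 2 / (4 * h ^ 2) - μ / (4 * h ^ 3)))) =
        (((N + p - 2) * μ / h + (p - 1) * (s₀ / h ^ 2) * (μ ^ 2 - μ / h)) / p) * G s₀ := by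
      field_simp
    rw [hexp] at hvisc
    have hle := le_of_mul_le_mul_right hvisc hG0
    rw [hl, div_le_div_iff_of_pos_right hp0] at hle
    have e1 : (N + p - 2) * μ / h ≤ (N + p - 2) * μ / δ := by gcongr
    have e2 : s₀ / h ^ 2 < 1 := by
      rw [div_lt_one (by positivity), hh2]
      have : 0 < δ ^ 2 := by positivity
      linarith
    have e3 : 0 ≤ (p - 1) * (s₀ / h ^ 2) * (μ / h) := by positivity
    have e4 : (p - 1) * μ ^ 2 * (s₀ / h ^ 2) < (p - 1) * μ ^ 2 * 1 := by gcongr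
    linarith [mul_sub ((p - 1) * (s₀ / h ^ 2)) (μ ^ 2) (μ / h)]
  refine (hsub y (mem_closedBall_self hr.le) t ht.le).trans (Real.exp_le_exp.2 ?_)
  have : √(‖y - y‖ ^ 2 + δ ^ 2) = δ := by simp [Real.sqrt_sq hδ.le]
  simp only [this]
  nlinarith

lemma exp_neg_mul_log_sub_div_bounds (n : ℕ) {b t : ℝ} (hb : 0 < b) (ht : 0 < t) :
    Real.exp (-(n * Real.log t) - b / t) * b ^ n ≤ n.factorial ∧
    Real.exp (-(n * Real.log t) - b / t) * b ^ (n + 1) ≤ (n + 1).factorial * t ∧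
    Real.exp (-(n * Real.log t) - b / t) * t ^ n ≤ 1 := by
  have hK : Real.exp (-(n * Real.log t) - b / t) = (t ^ n)⁻¹ * (Real.exp (b / t))⁻¹ := by
    rw [sub_eq_add_neg, Real.exp_add, Real.exp_neg, Real.exp_neg, Real.exp_nat_mul,
      Real.exp_log ht]
  have hbt : 0 < b / t := by positivity
  have hE := Real.exp_pos (b / t)
  have hpow : ∀ m : ℕ, (b / t) ^ m * (Real.exp (b / t))⁻¹ ≤ m.factorial := by
    intro m
    have h := Real.pow_div_factorial_le_exp (b / t) hbt.le m
    rw [div_le_iff₀ (by positivity)] at h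
    rw [← div_eq_mul_inv, div_le_iff₀ hE]
    linarith
  refine ⟨?_, ?_, ?_⟩
  · refine le_of_eq_of_le ?_ (hpow n)
    rw [hK, div_pow]
    ring
  · refine le_of_eq_of_le ?_ (mul_le_mul_of_nonneg_right (hpow (n + 1)) ht.le)
    rw [hK, div_pow]
    field_simp
    ring
  · rw [hK]
    have h1 : (Real.exp (b / t))⁻¹ ≤ 1 := inv_le_one_of_one_le₀ (Real.one_le_exp hbt.le)
    refine le_of_eq_of_le ?_ h1
    field_simp

lemma le_max_one_of_pow_le {a b : ℝ} {n : ℕ} (hn : n ≠ 0) (h : a ^ n ≤ b) : a ≤ max 1 b := by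
  by_cases ha : 1 ≤ a
  · exact ((le_self_pow₀ ha hn).trans h).trans (le_max_right _ _)
  · exact (not_le.1 ha).le.trans (le_max_left _ _)

lemma inv_le_quadratic {t t₀ : ℝ} (ht₀ : 0 < t₀) (ht : t₀ / 2 < t) :
    1 / t ≤ 1 / t₀ - (t - t₀) / t₀ ^ 2 + 2 / t₀ ^ 3 * (t - t₀) ^ 2 := by
  have ht0 : 0 < t := by linarith
  have h : 1 / t₀ - (t - t₀) / t₀ ^ 2 + 2 / t₀ ^ 3 * (t - t₀) ^ 2 - 1 / t =
      (t - t₀) ^ 2 * (2 * t - t₀) / (t₀ ^ 3 * t) := by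
    field_simp
    ring
  have : 0 ≤ (t - t₀) ^ 2 * (2 * t - t₀) / (t₀ ^ 3 * t) := by
    have : 0 ≤ 2 * t - t₀ := by linarith
    positivity
  linarith

/-- A Gaussian kernel with too large a power of `t` in front cannot touch from below a
viscosity solution. -/
lemma not_isLocalMinOn_sub_gaussian {N : ℕ} (hN : 2 ≤ N) {p : ℝ} (hp : 1 < p)
    {Ω : Set (EuclideanSpace ℝ (Fin N))}
    {u : EuclideanSpace ℝ (Fin N) → ℝ → ℝ} (hu : IsViscositySol p Ω u)
    {n : ℕ} (hn : (N + p - 2) / (2 * (p - 1)) < n) {A : ℝ} (hA : 0 < A)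
    {z x₀ : EuclideanSpace ℝ (Fin N)} {t₀ : ℝ} (hx₀ : x₀ ∈ Ω) (ht₀ : 0 < t₀) :
    ¬ IsLocalMinOn (fun q : EuclideanSpace ℝ (Fin N) × ℝ => u q.1 q.2 -
      A * Real.exp (-(n * Real.log q.2) - p / (4 * (p - 1)) * ‖q.1 - z‖ ^ 2 / q.2))
      (Ω ×ˢ Ioi 0) (x₀, t₀) := by
  intro hmin
  have hp1 : 0 < p - 1 := by linarith
  set β : ℝ := p / (4 * (p - 1)) with hβ
  have hβ0 : 0 < β := by positivity
  set φ : EuclideanSpace ℝ (Fin N) × ℝ → ℝ := fun q =>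
    A * Real.exp (-(n * (Real.log t₀ + (q.2 - t₀) / t₀)) - β * ‖q.1 - z‖ ^ 2 *
      (1 / t₀ - (q.2 - t₀) / t₀ ^ 2 + 2 / t₀ ^ 3 * (q.2 - t₀) ^ 2)) with hφ
  have hφC : ContDiff ℝ 2 φ := by
    have hn2 : ContDiff ℝ 2 fun q : EuclideanSpace ℝ (Fin N) × ℝ => ‖q.1 - z‖ ^ 2 :=
      (contDiff_fst.sub contDiff_const).norm_sq ℝ
    refine contDiff_const.mul (Real.contDiff_exp.comp ?_)
    fun_prop
  have hloc : IsLocalMinOn (fun q : EuclideanSpace ℝ (Fin N) × ℝ => u q.1 q.2 - φ q)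
      (Ω ×ˢ Ioi 0) (x₀, t₀) := by
    have hev : ∀ᶠ q : EuclideanSpace ℝ (Fin N) × ℝ in 𝓝[Ω ×ˢ Ioi 0] (x₀, t₀), t₀ / 2 < q.2 :=
      (continuous_snd.continuousWithinAt).eventually (lt_mem_nhds (by simpa using ht₀))
    filter_upwards [hmin, hev] with q hq hq2
    have hqpos : 0 < q.2 := by linarith
    have h1 : Real.log q.2 ≤ Real.log t₀ + (q.2 - t₀) / t₀ := by
      have := Real.log_le_sub_one_of_pos (div_pos hqpos ht₀)
      rw [Real.log_div hqpos.ne' ht₀.ne'] at this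
      have h2 : (q.2 - t₀) / t₀ = q.2 / t₀ - 1 := by field_simp
      linarith
    have h2 : φ q ≤ A * Real.exp (-(n * Real.log q.2) - β * ‖q.1 - z‖ ^ 2 / q.2) := by
      refine mul_le_mul_of_nonneg_left (Real.exp_le_exp.2 ?_) hA.le
      have h3 := mul_le_mul_of_nonneg_left (inv_le_quadratic ht₀ hq2)
        (by positivity : 0 ≤ β * ‖q.1 - z‖ ^ 2)
      have h4 := mul_le_mul_of_nonneg_left h1 (Nat.cast_nonneg n : (0 : ℝ) ≤ n)
      rw [mul_one_div] at h3
      linarith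
    have h3 : φ (x₀, t₀) =
        A * Real.exp (-(n * Real.log t₀) - β * ‖x₀ - z‖ ^ 2 / t₀) := by
      simp [hφ, div_eq_mul_inv]
    simp only [h3] at hq ⊢
    linarith
  have hvisc := hu.2.2 φ hφC x₀ hx₀ t₀ ht₀ hloc
  set G : ℝ → ℝ := fun s => A * Real.exp (-(n * Real.log t₀) - β / t₀ * s) with hGdef
  have hG : ∀ s, HasDerivAt G (-(β / t₀) * G s) s := by
    intro s
    refine ((((hasDerivAt_id' s).const_mul (β / t₀)).const_sub
      (-(n * Real.log t₀))).exp.const_mul A).congr_deriv ?_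
    simp only [hGdef]
    ring
  set s₀ := ‖x₀ - z‖ ^ 2 with hs₀
  have hG0 : 0 < G s₀ := by positivity
  have hrad := (Fupper_Flower_radial (z := z) (x := x₀) (by omega) p (fun s _ => hG s)
    ((hG _).const_mul (-(β / t₀))) (mul_ne_zero (by
      have : 0 < β / t₀ := by positivity
      linarith) hG0.ne')).2
  have hfun : (fun y => φ (y, t₀)) = fun y => G (‖y - z‖ ^ 2) := by
    funext y
    simp only [hφ, hGdef, sub_self, zero_div, add_zero, sub_zero]
    congr 2
    ring
  have hder : deriv (fun s => φ (x₀, s)) t₀ = (-(n / t₀) + β * s₀ / t₀ ^ 2) * G s₀ := by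
    have hid := (hasDerivAt_id' t₀).sub_const t₀
    have := ((((((hid.div_const t₀).const_add (Real.log t₀)).const_mul (n : ℝ)).neg).sub
      ((((hid.div_const (t₀ ^ 2)).const_sub (1 / t₀)).add
        ((hid.pow 2).const_mul (2 / t₀ ^ 3))).const_mul (β * s₀))).exp).const_mul A
    refine this.deriv.trans ?_
    simp only [hGdef]
    simp
    rw [show β * s₀ * t₀⁻¹ = β / t₀ * s₀ by ring]
    ring
  rw [hder, hfun, hrad, ← hs₀] at hvisc
  have hexp : 1 / p * (2 * (N + p - 2) * (-(β / t₀) * G s₀) +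
      4 * (p - 1) * s₀ * (-(β / t₀) * (-(β / t₀) * G s₀))) =
      (-(((N + p - 2) / (2 * (p - 1))) / t₀) + β * s₀ / t₀ ^ 2) * G s₀ := by
    rw [hβ]
    field_simp
    ring
  rw [hexp] at hvisc
  have h1 := le_of_mul_le_mul_right hvisc hG0
  have h2 : (N + p - 2) / (2 * (p - 1)) / t₀ < n / t₀ := by gcongr
  linarith

/-- Comparison from below with a Gaussian centred outside `closure Ω`. -/
lemma gaussian_le_sol {N : ℕ} (hN : 2 ≤ N) {p : ℝ} (hp : 1 < p)
    {Ω : Set (EuclideanSpace ℝ (Fin N))} (hΩo : IsOpen Ω)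
    {u : EuclideanSpace ℝ (Fin N) → ℝ → ℝ} (hu : IsSolP p Ω u)
    (hu0 : ∀ x ∈ Ω, ∀ t : ℝ, 0 < t → 0 < u x t)
    {n : ℕ} (hn : (N + p - 2) / (2 * (p - 1)) < n) {A : ℝ} (hA : 0 < A)
    {z : EuclideanSpace ℝ (Fin N)} {ρ : ℝ} (hρ : 0 < ρ)
    (hz : ∀ x ∈ closure Ω, ρ ≤ ‖x - z‖)
    (hAρ : A * n.factorial ≤ (p / (4 * (p - 1)) * ρ ^ 2) ^ n)
    {x : EuclideanSpace ℝ (Fin N)} (hx : x ∈ Ω) {t : ℝ} (ht : 0 < t) :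
    A * Real.exp (-(n * Real.log t) - p / (4 * (p - 1)) * ‖x - z‖ ^ 2 / t) ≤ u x t := by
  by_contra! hcon
  have hp1 : 0 < p - 1 := by linarith
  have hN2 : (2 : ℝ) ≤ N := by exact_mod_cast hN
  have hn0 : n ≠ 0 := by
    rintro rfl
    have : 0 < (N + p - 2) / (2 * (p - 1)) := div_pos (by linarith) (by linarith)
    simp only [Nat.cast_zero] at hn
    linarith
  set β : ℝ := p / (4 * (p - 1)) with hβ
  have hβ0 : 0 < β := by positivity
  set w : EuclideanSpace ℝ (Fin N) × ℝ → ℝ := fun q =>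
    A * Real.exp (-(n * Real.log q.2) - β * ‖q.1 - z‖ ^ 2 / q.2) with hw
  set ε : ℝ := w (x, t) - u x t with hε
  have hε0 : 0 < ε := sub_pos.2 hcon
  have hb : ∀ y ∈ closure Ω, β * ρ ^ 2 ≤ β * ‖y - z‖ ^ 2 := by
    intro y hy
    have := hz y hy
    gcongr
  have hw1 : ∀ y ∈ closure Ω, ∀ s, 0 < s → w (y, s) ≤ 1 := by
    intro y hy s hs
    have h1 := hb y hy
    have hbpos : 0 < β * ‖y - z‖ ^ 2 := lt_of_lt_of_le (by positivity) h1
    have h2 := (exp_neg_mul_log_sub_div_bounds n hbpos hs).1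
    have h3 : (β * ρ ^ 2) ^ n ≤ (β * ‖y - z‖ ^ 2) ^ n := by gcongr
    have h4 := mul_le_mul_of_nonneg_left h2 hA.le
    refine le_of_mul_le_mul_right (a := (β * ‖y - z‖ ^ 2) ^ n) ?_ (by positivity)
    simp only [hw]
    linarith
  set ta : ℝ := ε * (β * ρ ^ 2) ^ (n + 1) / (A * (n + 1).factorial) with hta
  have hta0 : 0 < ta := by positivity
  set tb : ℝ := max 1 (A / ε) with htb
  set R : ℝ := √(max 1 (A * n.factorial / ε) / β) with hR
  have hloc : ∀ y ∈ closure Ω, ∀ s, 0 < s → ε ≤ w (y, s) →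
      (y, s) ∈ (closure Ω ∩ closedBall z R) ×ˢ Icc ta tb := by
    intro y hy s hs hle
    have h1 := hb y hy
    have hbpos : 0 < β * ‖y - z‖ ^ 2 := lt_of_lt_of_le (by positivity) h1
    obtain ⟨b1, b2, b3⟩ := exp_neg_mul_log_sub_div_bounds n hbpos hs
    replace b1 := mul_le_mul_of_nonneg_left b1 hA.le
    replace b2 := mul_le_mul_of_nonneg_left b2 hA.le
    replace b3 := mul_le_mul_of_nonneg_left b3 hA.le
    rw [← mul_assoc] at b1 b2 b3
    refine ⟨⟨hy, ?_⟩, ?_, ?_⟩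
    · have h2 := mul_le_mul_of_nonneg_right hle (by positivity : 0 ≤ (β * ‖y - z‖ ^ 2) ^ n)
      have h3 : β * ‖y - z‖ ^ 2 ≤ max 1 (A * n.factorial / ε) := by
        refine le_max_one_of_pow_le hn0 ?_
        rw [le_div_iff₀ hε0]
        linarith
      rw [mem_closedBall, dist_eq_norm]
      refine Real.le_sqrt_of_sq_le ?_
      rw [le_div_iff₀ hβ0]
      linarith
    · have h2 := mul_le_mul_of_nonneg_right hle
        (by positivity : 0 ≤ (β * ‖y - z‖ ^ 2) ^ (n + 1))
      have h3 : ε * (β * ρ ^ 2) ^ (n + 1) ≤ ε * (β * ‖y - z‖ ^ 2) ^ (n + 1) := by gcongr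
      rw [hta, div_le_iff₀ (by positivity)]
      linarith
    · have h2 := mul_le_mul_of_nonneg_right hle (by positivity : 0 ≤ s ^ n)
      refine le_max_one_of_pow_le hn0 ?_
      rw [le_div_iff₀ hε0]
      linarith
  have hcont : ContinuousOn (fun q : EuclideanSpace ℝ (Fin N) × ℝ => u q.1 q.2 - w q)
      ((closure Ω ∩ closedBall z R) ×ˢ Icc ta tb) := by
    refine ContinuousOn.sub ?_ ?_
    · rintro ⟨y, s⟩ ⟨hy, hs⟩
      have hs0 : 0 < s := hta0.trans_le hs.1
      exact (hu.2.1 y hy.1 s hs0.le fun h => hs0.ne' h.2).mono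
        (prod_mono inter_subset_left fun _ h => hta0.le.trans h.1)
    · have hne : ∀ q ∈ (closure Ω ∩ closedBall z R) ×ˢ Icc ta tb, q.2 ≠ 0 :=
        fun q hq => (hta0.trans_le hq.2.1).ne'
      have hq2 : ContinuousOn (fun q : EuclideanSpace ℝ (Fin N) × ℝ => q.2)
        ((closure Ω ∩ closedBall z R) ×ˢ Icc ta tb) := continuous_snd.continuousOn
      refine continuousOn_const.mul (ContinuousOn.rexp (ContinuousOn.sub ?_ ?_))
      · exact (continuousOn_const.mul (hq2.log hne)).neg
      · exact ContinuousOn.div (by fun_prop) hq2 hne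
  have hmem : (x, t) ∈ (closure Ω ∩ closedBall z R) ×ˢ Icc ta tb :=
    hloc x (subset_closure hx) t ht (by linarith [hu0 x hx t ht])
  obtain ⟨⟨x₀, t₀⟩, hq₀, hmin⟩ :=
    (((isCompact_closedBall z R).inter_left isClosed_closure).prod isCompact_Icc).exists_isMinOn
      ⟨(x, t), hmem⟩ hcont
  have ht₀ : 0 < t₀ := hta0.trans_le hq₀.2.1
  have hle : u x₀ t₀ - w (x₀, t₀) ≤ -ε := by
    have : u x₀ t₀ - w (x₀, t₀) ≤ u x t - w (x, t) := hmin hmem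
    linarith
  have hx₀ : x₀ ∈ Ω := by
    by_contra hx₀
    have hfr : x₀ ∈ frontier Ω := by
      rw [hΩo.frontier_eq]
      exact ⟨hq₀.1.1, hx₀⟩
    have h1 := hu.2.2.2.2 x₀ hfr t₀ ht₀
    have h2 := hw1 x₀ hq₀.1.1 t₀ ht₀
    linarith
  refine not_isLocalMinOn_sub_gaussian hN hp hu.2.2.1 hn hA (z := z) hx₀ ht₀ (IsMinOn.localize ?_)
  rintro ⟨y, s⟩ ⟨hy, hs⟩
  by_cases hys : ε ≤ w (y, s)
  · exact hmin (hloc y (subset_closure hy) s hs hys)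
  · have h1 := hu0 y hy s hs
    change u x₀ t₀ - w (x₀, t₀) ≤ u y s - w (y, s)
    linarith

/-- For small times a bounded solution is larger at points closer to the boundary. -/
lemma exists_sol_lt_of_infDist_lt {N : ℕ} (hN : 2 ≤ N) {p : ℝ} (hp : 1 < p)
    {Ω : Set (EuclideanSpace ℝ (Fin N))} (hΩo : IsOpen Ω) (hΓ : (frontier Ω).Nonempty)
    (hΓ' : frontier Ω ⊆ frontier ((closure Ω)ᶜ))
    {u : EuclideanSpace ℝ (Fin N) → ℝ → ℝ} (hu : IsSolP p Ω u)
    (hupos : ∀ x ∈ Ω, ∀ t : ℝ, 0 < t → 0 < u x t ∧ u x t < 1)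
    {x y : EuclideanSpace ℝ (Fin N)} (hx : x ∈ Ω) (hy : y ∈ Ω)
    (hlt : infDist x (frontier Ω) < infDist y (frontier Ω)) :
    ∃ t, 0 < t ∧ u y t < u x t := by
  have hp1 : 0 < p - 1 := by linarith
  set β : ℝ := p / (4 * (p - 1)) with hβ
  have hβ0 : 0 < β := by positivity
  have hd₁ : 0 ≤ infDist x (frontier Ω) := infDist_nonneg
  set d₁ := infDist x (frontier Ω) with hd₁def
  set d₂ := infDist y (frontier Ω)
  set δ := (d₂ - d₁) / 4 with hδdef
  have hδ : 0 < δ := by linarith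
  obtain ⟨y₀, hy₀, hxy₀⟩ := isClosed_frontier.exists_infDist_eq_dist hΓ x
  obtain ⟨z, hz, hzy₀⟩ := Metric.mem_closure_iff.1 (frontier_subset_closure (hΓ' hy₀)) δ hδ
  have hD : ‖x - z‖ < d₁ + δ := by
    rw [← dist_eq_norm]
    linarith [dist_triangle x y₀ z]
  have hne : (closure Ω).Nonempty := ⟨x, subset_closure hx⟩
  have hρ : 0 < infDist z (closure Ω) := (isClosed_closure.notMem_iff_infDist_pos hne).1 hz
  set ρ := infDist z (closure Ω)
  obtain ⟨n, hn⟩ := exists_nat_gt ((N + p - 2) / (2 * (p - 1)))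
  set A : ℝ := (β * ρ ^ 2) ^ n / n.factorial with hAdef
  have hA : 0 < A := by positivity
  have hlow : ∀ t, 0 < t → A * Real.exp (-(n * Real.log t) - β * ‖x - z‖ ^ 2 / t) ≤ u x t :=
    fun t ht => gaussian_le_sol hN hp hΩo hu (fun x hx t ht => (hupos x hx t ht).1) hn hA hρ
      (fun x hx => by
        rw [← dist_eq_norm, dist_comm]
        exact infDist_le_dist_of_mem hx)
      (by rw [hAdef, div_mul_cancel₀ _ (by positivity)]) hx ht
  set r := d₂ - δ with hr
  have hr0 : 0 < r := by linarith
  set m := r - δ with hm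
  have hm0 : 0 < m := by linarith
  have hDm : ‖x - z‖ < m := by linarith
  set K : ℝ := (N + p - 2) * (2 * β * m) / δ / p with hK
  have hup : ∀ t, 0 < t → u y t ≤ Real.exp (K - β * m ^ 2 / t) := by
    intro t ht
    refine (sol_le_exp_of_closedBall_subset hN hp hΩo hu (fun x hx t ht => (hupos x hx t ht).2)
      hr0 hδ (by positivity : 0 < 2 * β * m / t)
      (closedBall_subset_of_lt_infDist_frontier hΩo hy hr0.le (by linarith)) ht).trans_eq ?_
    congr 1
    rw [← hm, hK]
    have hβp : 4 * (p - 1) * β = p := by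
      rw [hβ]
      field_simp
    clear_value β m δ
    field_simp
    linear_combination m * δ * hβp
  have hgap : 0 < β * (m ^ 2 - ‖x - z‖ ^ 2) := by
    have : ‖x - z‖ ^ 2 < m ^ 2 := by gcongr
    exact mul_pos hβ0 (by linarith)
  set g := β * (m ^ 2 - ‖x - z‖ ^ 2) with hg
  set M := |K - Real.log A| + 1 with hM
  have hM0 : 0 < M := by positivity
  have hMK : K - Real.log A < M := by linarith [le_abs_self (K - Real.log A)]
  have ht : 0 < min 1 (g / M) := lt_min one_pos (by positivity)
  set t := min 1 (g / M) with htdef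
  refine ⟨t, ht, (hup t ht).trans_lt (lt_of_lt_of_le ?_ (hlow t ht))⟩
  have hMt : M ≤ g / t := by
    rw [le_div_iff₀ ht, mul_comm, ← le_div_iff₀ hM0]
    exact min_le_right _ _
  have hlogt : n * Real.log t ≤ 0 :=
    mul_nonpos_of_nonneg_of_nonpos (Nat.cast_nonneg n)
      (Real.log_nonpos ht.le (min_le_left _ _))
  rw [← Real.exp_log hA, ← Real.exp_add, Real.exp_lt_exp]
  have hsplit : g / t = β * m ^ 2 / t - β * ‖x - z‖ ^ 2 / t := by
    rw [hg]
    ring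
  linarith

/-- any time-invariant level set `Σ ⊆ Ω` of `u` is at constant (positive)
distance from the boundary `Γ`. -/
theorem stmt18 (N : ℕ) (hN : 2 ≤ N) (p : ℝ) (hp : 1 < p)
    (Ω : Set (EuclideanSpace ℝ (Fin N))) (hΩo : IsOpen Ω) (hΩc : IsConnected Ω)
    (hΓ : (frontier Ω).Nonempty)
    (hΓ' : frontier Ω = frontier ((closure Ω)ᶜ))
    (u : EuclideanSpace ℝ (Fin N) → ℝ → ℝ) (hu : IsSolP p Ω u)
    (hupos : ∀ x ∈ Ω, ∀ t : ℝ, 0 < t → 0 < u x t ∧ u x t < 1)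
    (Sig : Set (EuclideanSpace ℝ (Fin N))) (hSigsub : Sig ⊆ Ω) (hSigne : Sig.Nonempty)
    (a : ℝ → ℝ) (ha : ∀ x ∈ Sig, ∀ t : ℝ, 0 < t → u x t = a t) :
    ∃ R : ℝ, 0 < R ∧ ∀ x ∈ Sig, Metric.infDist x (frontier Ω) = R := by
  obtain ⟨x₀, hx₀⟩ := hSigne
  have hx₀Γ : x₀ ∉ frontier Ω := fun h => (hΩo.frontier_eq ▸ h).2 (hSigsub hx₀)
  have key : ∀ x ∈ Sig, ∀ y ∈ Sig, infDist y (frontier Ω) ≤ infDist x (frontier Ω) := by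
    intro x hx y hy
    by_contra! hlt
    obtain ⟨t, ht, hut⟩ := exists_sol_lt_of_infDist_lt hN hp hΩo hΓ hΓ'.le hu hupos
      (hSigsub hx) (hSigsub hy) hlt
    rw [ha x hx t ht, ha y hy t ht] at hut
    exact lt_irrefl _ hut
  exact ⟨infDist x₀ (frontier Ω), (isClosed_frontier.notMem_iff_infDist_pos hΓ).1 hx₀Γ,
    fun x hx => le_antisymm (key x₀ hx₀ x hx) (key x hx x₀ hx₀)⟩

end
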